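/- arXiv:1512.06352 — 7 statements merged into one kernel-verified Lean document; each statement's English description precedes it below -/
import Mathlib

section
/- Let q be a prime power, t ≥ 1, h ≥ 1, and let C_{i_1}, …, C_{i_{h−1}} be distinct elements of the MRD code D_t = {0_t, I_t, C, …, C^{q^t−2}} generated by the companion matrix C of a primitive polynomial of degree t over F_q. Then the (ht)×(ht) block matrix whose j-th block-row, for 1 ≤ j ≤ h−1, is (I_t, C_{i_j}, C_{i_j}^2, …, C_{i_j}^{h−1}), and whose last block-row is (0_t, 0_t, …, 0_t, I_t), is invertible over F_q. -/
open Polynomial Matrix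

/-- The companion matrix of a monic polynomial `p` of degree `t` over `F`. -/
def companionMatrix {F : Type*} [Field F] (t : ℕ) (p : F[X]) :
    Matrix (Fin t) (Fin t) F :=
  Matrix.of fun i j : Fin t =>
    if (i : ℕ) + 1 = t then -(p.coeff (j : ℕ))
    else if (i : ℕ) + 1 = (j : ℕ) then 1 else 0

/-- The companion matrix is the transpose of the matrix of multiplication by the root of `p`
in the power basis of `AdjoinRoot p`. -/
lemma companionMatrix_eq_transpose_leftMulMatrix {F : Type*} [Field F] {p : F[X]}
    (hp : p.Monic) :
    companionMatrix p.natDegree p =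
      (Algebra.leftMulMatrix (AdjoinRoot.powerBasis' hp).basis (AdjoinRoot.root p))ᵀ := by
  have hmin : (AdjoinRoot.powerBasis' hp).minpolyGen = p := by
    rw [PowerBasis.minpolyGen_eq, AdjoinRoot.powerBasis'_gen, AdjoinRoot.minpoly_root hp.ne_zero,
      hp.leadingCoeff, inv_one, C_1, mul_one]
  have hmul := (AdjoinRoot.powerBasis' hp).leftMulMatrix
  rw [hmin, AdjoinRoot.powerBasis'_gen] at hmul
  rw [hmul]
  ext i j
  exact if_congr Iff.rfl rfl (if_congr eq_comm rfl rfl)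

/-- The ring homomorphism from `AdjoinRoot p` to matrices sending the root to the companion
matrix of `p`. -/
noncomputable def companionRingHom {F : Type*} [Field F] {p : F[X]} (hp : p.Monic) :
    AdjoinRoot p →+* Matrix (Fin p.natDegree) (Fin p.natDegree) F where
  toFun x := (Algebra.leftMulMatrix (AdjoinRoot.powerBasis' hp).basis x)ᵀ
  map_one' := by rw [map_one]; exact transpose_one
  map_zero' := by rw [map_zero]; exact transpose_zero
  map_add' x y := by rw [map_add]; exact transpose_add _ _
  map_mul' x y := by rw [mul_comm, map_mul]; exact transpose_mul _ _

lemma companionRingHom_root {F : Type*} [Field F] {p : F[X]} (hp : p.Monic) :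
    companionRingHom hp (AdjoinRoot.root p) = companionMatrix p.natDegree p :=
  (companionMatrix_eq_transpose_leftMulMatrix hp).symm

/-- A Vandermonde matrix with distinct nodes whose last row, corresponding to the point at
infinity, is a unit vector is invertible. -/
lemma isUnit_vandermonde_with_unit_row {K : Type*} [Field K] {n : ℕ} {a : Fin n → K}
    (ha : Function.Injective a) :
    IsUnit (Matrix.of fun i j : Fin (n + 1) =>
      if hi : (i : ℕ) < n then a ⟨i, hi⟩ ^ (j : ℕ) else if (j : ℕ) = n then 1 else 0) := by
  set v : Fin (n + 1) → K := Fin.snoc a 1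
  set w : Fin (n + 1) → K := Fin.snoc (fun _ => 1) 0
  have heq : (Matrix.of fun i j : Fin (n + 1) =>
      if hi : (i : ℕ) < n then a ⟨i, hi⟩ ^ (j : ℕ) else if (j : ℕ) = n then 1 else 0) =
      projVandermonde v w := by
    ext i j
    induction i using Fin.lastCases with
    | last =>
      rw [projVandermonde_apply_zero_right (by simp [w])]
      simp [v, Pi.single_apply, Fin.ext_iff]
    | cast i => simp [projVandermonde_apply, v, w]
  rw [heq, Matrix.isUnit_iff_isUnit_det, isUnit_iff_ne_zero, det_projVandermonde]
  refine Finset.prod_ne_zero_iff.2 fun i _ => Finset.prod_ne_zero_iff.2 fun j hj => ?_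
  have hij := Finset.mem_Ioi.1 hj
  induction i using Fin.lastCases with
  | last => exact absurd hij (Fin.le_last j).not_gt
  | cast i =>
    induction j using Fin.lastCases with
    | last => simp [v, w]
    | cast j =>
      have hne : a j ≠ a i := ha.ne (Fin.castSucc_lt_castSucc_iff.1 hij).ne'
      simpa [v, w, sub_eq_zero] using hne

/-- Let `C_{i_1}, …, C_{i_{h-1}}` be distinct elements of the MRD code
`D_t = {0_t, I_t, C, …, C^{q^t-2}}` generated by the companion matrix `C` of a
primitive polynomial of degree `t ≥ 1` over `F_q`.  Then the `(ht)×(ht)` block matrix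
whose `j`-th block-row, for `1 ≤ j ≤ h-1`, is `(I_t, C_{i_j}, C_{i_j}^2, …, C_{i_j}^{h-1})`
and whose last block-row is `(0_t, …, 0_t, I_t)` is invertible over `F_q`. -/
theorem block_vandermonde_with_unit_row_invertible
    (F : Type*) [Field F] [Fintype F]
    (t : ℕ) (ht : 1 ≤ t)
    (p : F[X]) (hmonic : p.Monic) (hdeg : p.natDegree = t) (hirr : Irreducible p)
    (hprim : orderOf (AdjoinRoot.root p) = Fintype.card F ^ t - 1)
    (C : Matrix (Fin t) (Fin t) F) (hC : C = companionMatrix t p)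
    (D : Set (Matrix (Fin t) (Fin t) F))
    (hD : D = {0} ∪ {A | ∃ i ≤ Fintype.card F ^ t - 2, A = C ^ i})
    (h : ℕ) (hh : 1 ≤ h)
    (Cm : Fin (h - 1) → Matrix (Fin t) (Fin t) F)
    (hCmD : ∀ j, Cm j ∈ D) (hCminj : Function.Injective Cm)
    (M : Matrix (Fin h × Fin t) (Fin h × Fin t) F)
    (hM : M = Matrix.of fun (ia jb : Fin h × Fin t) =>
      if hi : (ia.1 : ℕ) < h - 1 then
        ((Cm ⟨(ia.1 : ℕ), hi⟩) ^ (jb.1 : ℕ)) ia.2 jb.2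
      else
        if (jb.1 : ℕ) = h - 1 then (1 : Matrix (Fin t) (Fin t) F) ia.2 jb.2 else 0) :
    IsUnit M := by
  subst hdeg hC hD hM
  obtain ⟨n, rfl⟩ : ∃ n, h = n + 1 := ⟨h - 1, by omega⟩
  have : Fact (Irreducible p) := ⟨hirr⟩
  have hlift : ∀ j, ∃ x, companionRingHom hmonic x = Cm j := fun j => by
    rcases hCmD j with h0 | ⟨i, -, hi⟩
    · exact ⟨0, (map_zero _).trans h0.symm⟩
    · exact ⟨AdjoinRoot.root p ^ i, by rw [map_pow, companionRingHom_root, hi]⟩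
  choose a ha using hlift
  have ha_inj : Function.Injective a := fun i j hij => hCminj (by rw [← ha, ← ha, hij])
  convert! ((isUnit_vandermonde_with_unit_row ha_inj).map (companionRingHom hmonic).mapMatrix).map
    (compRingEquiv (Fin (n + 1)) (Fin p.natDegree) F) using 1
  ext ⟨i, k⟩ ⟨j, l⟩
  simp only [Nat.add_sub_cancel, of_apply, compRingEquiv_apply, comp_apply,
    RingHom.mapMatrix_apply, map_apply]
  split_ifs
  · rw [map_pow, ha]
  · rw [map_one]
  · rw [map_zero]; rfl
end

section
/- Let q be a prime power and ℓ ≥ 2. The maximum cardinality of a finite set S of subspaces of F_q^{2ℓ}, each of dimension at most ℓ, such that for any two distinct U, V ∈ S the subspace U + V has dimension at least ℓ + 1, is exactly the Gaussian binomial [2ℓ choose ℓ]_q, and this maximum is attained by the set of all ℓ-dimensional subspaces of F_q^{2ℓ}. -/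
open Module

/-- A subspace of a finite-dimensional space is contained in one of any prescribed larger
dimension. -/
theorem Submodule.exists_le_finrank_eq {K V : Type*} [DivisionRing K] [AddCommGroup V]
    [Module K V] [FiniteDimensional K V] (U : Submodule K V) {n : ℕ}
    (hU : finrank K U ≤ n) (hn : n ≤ finrank K V) :
    ∃ W : Submodule K V, U ≤ W ∧ finrank K W = n := by
  induction n, hU using Nat.le_induction with
  | base => exact ⟨U, le_rfl, rfl⟩
  | succ n _ ih =>
    obtain ⟨W, hUW, hW⟩ := ih (by omega)
    have hlt : W < ⊤ := lt_top_iff_ne_top.2 fun h => by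
      rw [h, finrank_top] at hW
      omega
    obtain ⟨x, -, hx⟩ := SetLike.exists_of_lt hlt
    exact ⟨W ⊔ Submodule.span K {x}, hUW.trans le_sup_left,
      by rw [Submodule.finrank_sup_span_singleton hx, hW]⟩

/-- Let `q` be a prime power (realized as the cardinality of a finite field `F`) and
`ℓ ≥ 2`.  The maximum cardinality of a finite set `S` of subspaces of `F_q^{2ℓ}`, each
of dimension at most `ℓ`, such that for any two distinct `U, V ∈ S` the subspace
`U + V` has dimension at least `ℓ + 1`, is exactly the Gaussian binomial
`[2ℓ choose ℓ]_q`, i.e. the number of `ℓ`-dimensional subspaces of `F_q^{2ℓ}`; and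
this maximum is attained by the set of all `ℓ`-dimensional subspaces of `F_q^{2ℓ}`. -/
theorem max_family_of_subspaces_dim_two_ell
    (F : Type*) [Field F] [Fintype F] (ℓ : ℕ) (hℓ : 2 ≤ ℓ) :
    IsGreatest {m : ℕ | ∃ S : Set (Submodule F (Fin (2 * ℓ) → F)),
        (∀ U ∈ S, Module.finrank F ↥U ≤ ℓ) ∧
        (∀ U ∈ S, ∀ V ∈ S, U ≠ V → ℓ + 1 ≤ Module.finrank F ↥(U ⊔ V)) ∧
        Nat.card S = m}
      (Nat.card {U : Submodule F (Fin (2 * ℓ) → F) | Module.finrank F ↥U = ℓ}) ∧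
    (∀ U V : Submodule F (Fin (2 * ℓ) → F), Module.finrank F ↥U = ℓ →
      Module.finrank F ↥V = ℓ → U ≠ V → ℓ + 1 ≤ Module.finrank F ↥(U ⊔ V)) := by
  have hsup : ∀ U V : Submodule F (Fin (2 * ℓ) → F), finrank F U = ℓ →
      finrank F V = ℓ → U ≠ V → ℓ + 1 ≤ finrank F ↥(U ⊔ V) := by
    intro U V hU hV hne
    have hlt : U < U ⊔ V := left_lt_sup.2 fun h =>
      hne (Submodule.eq_of_le_of_finrank_eq h (hV.trans hU.symm)).symm
    have := Submodule.finrank_lt_finrank_of_lt hlt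
    omega
  refine ⟨⟨⟨{U | finrank F U = ℓ}, fun U hU => le_of_eq hU,
    fun U hU V hV hne => hsup U V hU hV hne, rfl⟩, ?_⟩, hsup⟩
  rintro _ ⟨S, hdim, hjoin, rfl⟩
  have hext : ∀ U : S, ∃ W : Submodule F (Fin (2 * ℓ) → F), U.1 ≤ W ∧ finrank F W = ℓ :=
    fun U => U.1.exists_le_finrank_eq (hdim U U.2) (by simp; omega)
  choose W hle hW using hext
  refine Nat.card_le_card_of_injective
    (fun U : S => (⟨W U, hW U⟩ : {U : Submodule F (Fin (2 * ℓ) → F) | finrank F U = ℓ})) ?_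
  intro U V hUV
  by_contra hne
  have hWUV : W U = W V := congrArg Subtype.val hUV
  have h₁ := hjoin U U.2 V V.2 (Subtype.coe_injective.ne hne)
  have h₂ := Submodule.finrank_mono (sup_le (hle U) (hWUV ▸ hle V))
  have h₃ := hW U
  omega
end

section
/- Let q be a prime power and let δ, k, n be integers with 1 ≤ δ ≤ k ≤ n − k. Then there exists a set C of k-dimensional subspaces of F_q^n with |C| ≥ q^{(n−k)(k−δ+1)} such that any two distinct subspaces U, V ∈ C satisfy d_S(U,V) ≥ 2δ, where d_S is the subspace distance. In other words, A_q(n,k,2δ) ≥ q^{(n−k)(k−δ+1)}. -/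
open Module

open Polynomial in
/-- A nonzero linearized polynomial of `q`-degree less than `r` has a kernel of dimension less
than `r`. -/
theorem finrank_ker_linearized_lt {F K : Type*} [Field F] [Fintype F] [Field K] [Finite K]
    [Algebra F K] {r : ℕ} {a : Fin r → K} (ha : a ≠ 0) {f : K →ₗ[F] K}
    (hf : ∀ x, f x = ∑ i, a i * x ^ Fintype.card F ^ (i : ℕ)) :
    finrank F (LinearMap.ker f) < r := by
  classical
  have := Fintype.ofFinite K
  have hq : 1 < Fintype.card F := Fintype.one_lt_card
  obtain ⟨j, hj⟩ := Function.ne_iff.mp ha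
  let P : K[X] := ∑ i : Fin r, C (a i) * X ^ Fintype.card F ^ (i : ℕ)
  have hcoeff : P.coeff (Fintype.card F ^ (j : ℕ)) = a j := by
    simp only [P, finsetSum_coeff, coeff_C_mul, coeff_X_pow, Nat.pow_right_inj hq, Fin.val_inj]
    simp
  have hP : P ≠ 0 := fun h => hj (by simp [← hcoeff, h])
  have hdeg : P.natDegree ≤ Fintype.card F ^ (r - 1) :=
    natDegree_sum_le_of_forall_le _ _ fun i _ =>
      (natDegree_C_mul_X_pow_le _ _).trans (Nat.pow_le_pow_right hq.le (by omega))
  have hroots : (LinearMap.ker f : Set K).toFinset.card ≤ P.natDegree := by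
    refine card_le_degree_of_subset_roots fun x hx => ?_
    have hx : f x = 0 := by simpa using hx
    rw [mem_roots hP, IsRoot, ← hx, hf]
    simp [P, eval_finsetSum]
  have hcard : Fintype.card F ^ finrank F (LinearMap.ker f) ≤ Fintype.card F ^ (r - 1) := by
    rw [← Module.card_eq_pow_finrank (K := F) (V := LinearMap.ker f)]
    rw [Set.toFinset_card] at hroots
    exact hroots.trans hdeg
  have hle := (Nat.pow_le_pow_iff_right hq).mp hcard
  have := j.pos
  omega

/-- The `F`-linear map `x ↦ ∑ i, a i * x ^ (q ^ i)` attached to a linearized polynomial over `K`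
with coefficients `a`, where `q` is the order of `F`. -/
noncomputable def linearizedMap (F : Type*) {K : Type*} [Field F] [Fintype F] [Field K]
    [Algebra F K] {r : ℕ} (a : Fin r → K) : K →ₗ[F] K :=
  ∑ i, LinearMap.mulLeft F (a i) ∘ₗ (FiniteField.frobeniusAlgHom F K ^ (i : ℕ)).toLinearMap

theorem linearizedMap_apply (F : Type*) {K : Type*} [Field F] [Fintype F] [Field K]
    [Algebra F K] {r : ℕ} (a : Fin r → K) (x : K) :
    linearizedMap F a x = ∑ i, a i * x ^ Fintype.card F ^ (i : ℕ) := by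
  simp [linearizedMap, AlgHom.coe_pow, FiniteField.coe_frobeniusAlgHom, pow_iterate]

theorem finrank_ker_linearizedMap_sub_lt {F K : Type*} [Field F] [Fintype F] [Field K]
    [Finite K] [Algebra F K] {r : ℕ} {a b : Fin r → K} (hab : a ≠ b) :
    finrank F (LinearMap.ker (linearizedMap F a - linearizedMap F b)) < r :=
  finrank_ker_linearized_lt (sub_ne_zero.mpr hab) fun x => by
    simp [linearizedMap_apply, sub_mul, Finset.sum_sub_distrib]

theorem LinearMap.finrank_graph {F V W : Type*} [Field F] [AddCommGroup V] [AddCommGroup W]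
    [Module F V] [Module F W] (f : V →ₗ[F] W) : finrank F f.graph = finrank F V := by
  rw [LinearMap.graph_eq_range_prod]
  exact LinearMap.finrank_range_of_inj fun x y h => congrArg Prod.fst h

theorem LinearMap.finrank_graph_inf_graph_le {F V W : Type*} [Field F] [AddCommGroup V]
    [AddCommGroup W] [Module F V] [Module F W] [FiniteDimensional F V] (f g : V →ₗ[F] W) :
    finrank F ↥(f.graph ⊓ g.graph) ≤ finrank F (LinearMap.ker (f - g)) := by
  have hle : f.graph ⊓ g.graph ≤ (LinearMap.ker (f - g)).map (LinearMap.id.prod f) := by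
    rintro ⟨x, y⟩ ⟨hf, hg⟩
    have hf : y = f x := hf
    have hg : y = g x := hg
    exact ⟨x, by simp [← hf, ← hg], by simp [hf]⟩
  exact (Submodule.finrank_mono hle).trans (Submodule.finrank_map_le _ _)

/-- Lifting maps with pairwise differences of small kernel to their graphs gives a constant
dimension code. -/
theorem exists_code_of_finrank_ker_sub_le {F V W E ι : Type*} [Field F] [AddCommGroup V]
    [AddCommGroup W] [AddCommGroup E] [Module F V] [Module F W] [Module F E]
    [FiniteDimensional F V] [FiniteDimensional F W] [FiniteDimensional F E]
    (hE : finrank F V + finrank F W = finrank F E) {δ : ℕ} (hδ : 0 < δ) (f : ι → V →ₗ[F] W)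
    (hf : ∀ a b, a ≠ b → finrank F (LinearMap.ker (f a - f b)) + δ ≤ finrank F V) :
    ∃ C : Set (Submodule F E),
      (∀ U ∈ C, finrank F U = finrank F V) ∧
      (∀ U ∈ C, ∀ U' ∈ C, U ≠ U' →
        2 * δ ≤ 2 * finrank F ↥(U ⊔ U') - finrank F U - finrank F U') ∧
      Nat.card C = Nat.card ι := by
  let e : (V × W) ≃ₗ[F] E := LinearEquiv.ofFinrankEq _ _ (by rw [finrank_prod, hE])
  let G : ι → Submodule F E := fun a => (f a).graph.map (e : (V × W) →ₗ[F] E)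
  have hG : ∀ a, finrank F (G a) = finrank F V := fun a => by
    rw [LinearEquiv.finrank_map_eq, LinearMap.finrank_graph]
  have hinf : ∀ a b, a ≠ b → finrank F ↥(G a ⊓ G b) + δ ≤ finrank F V := fun a b hab => by
    rw [← Submodule.map_inf _ e.injective, LinearEquiv.finrank_map_eq]
    have := LinearMap.finrank_graph_inf_graph_le (f a) (f b)
    have := hf a b hab
    omega
  have hinj : Function.Injective G := fun a b h => by
    by_contra hab
    have := hinf a b hab
    rw [h, inf_idem, hG] at this
    omega
  refine ⟨Set.range G, ?_, ?_, Nat.card_range_of_injective hinj⟩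
  · rintro _ ⟨a, rfl⟩
    exact hG a
  · rintro _ ⟨a, rfl⟩ _ ⟨b, rfl⟩ hab
    have hdim := Submodule.finrank_sup_add_finrank_inf_eq (G a) (G b)
    have := hinf a b (ne_of_apply_ne G hab)
    rw [hG, hG] at *
    omega

/-- Let `q` be a prime power (realized as the cardinality of a finite field `F`) and
let `1 ≤ δ ≤ k ≤ n - k`.  Then there exists a set `C` of `k`-dimensional subspaces of
`F_q^n` with `|C| ≥ q^{(n-k)(k-δ+1)}` such that any two distinct `U, V ∈ C` are at
subspace distance `d_S(U,V) = 2·dim(U+V) − dim U − dim V ≥ 2δ`.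
In other words, `A_q(n,k,2δ) ≥ q^{(n-k)(k-δ+1)}`. -/
theorem constant_dimension_code_lower_bound
    (F : Type*) [Field F] [Fintype F] (n k δ : ℕ)
    (hδ1 : 1 ≤ δ) (hδk : δ ≤ k) (hkn : k ≤ n - k) :
    ∃ C : Set (Submodule F (Fin n → F)),
      (∀ U ∈ C, Module.finrank F ↥U = k) ∧
      (∀ U ∈ C, ∀ V ∈ C, U ≠ V →
        2 * δ ≤ 2 * Module.finrank F ↥(U ⊔ V)
          - Module.finrank F ↥U - Module.finrank F ↥V) ∧
      Fintype.card F ^ ((n - k) * (k - δ + 1)) ≤ Nat.card C := by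
  obtain ⟨p, _⟩ := CharP.exists F
  have : Fact p.Prime := ⟨CharP.char_is_prime F p⟩
  have : NeZero (n - k) := ⟨by omega⟩
  let K := FiniteField.Extension F p (n - k)
  have hK : finrank F K = n - k := FiniteField.finrank_extension F p (n - k)
  obtain ⟨ι, hι⟩ : ∃ ι : (Fin k → F) →ₗ[F] K, Function.Injective ι := by
    obtain ⟨v, hv⟩ := exists_linearIndependent_of_le_finrank (hkn.trans_eq hK.symm)
    exact ⟨Fintype.linearCombination F v, hv.fintypeLinearCombination_injective⟩
  obtain ⟨C, hdim, hdist, hcard⟩ := exists_code_of_finrank_ker_sub_le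
    (F := F) (V := Fin k → F) (W := K) (E := Fin n → F) (by simp [hK]; omega) hδ1
    (fun a : Fin (k - δ + 1) → K => linearizedMap F a ∘ₗ ι) (fun a b hab => by
      have hlt := finrank_ker_linearizedMap_sub_lt (F := F) hab
      have hle : finrank F (LinearMap.ker (linearizedMap F a ∘ₗ ι - linearizedMap F b ∘ₗ ι)) ≤
          finrank F (LinearMap.ker (linearizedMap F a - linearizedMap F b)) := by
        rw [← LinearMap.sub_comp, LinearMap.ker_comp,
          (Submodule.equivMapOfInjective ι hι _).finrank_eq]
        exact Submodule.finrank_mono (Submodule.map_comap_le _ _)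
      rw [finrank_fin_fun]
      omega)
  refine ⟨C, by simpa using hdim, hdist, ?_⟩
  rw [hcard, Nat.card_fun, FiniteField.natCard_extension]
  simp [pow_mul]
end

section
/- Let q be a prime power and let δ, k, n be integers with 1 < δ ≤ k ≤ n − k. Then every set C of k-dimensional subspaces of F_q^n in which any two distinct subspaces are at subspace distance at least 2δ satisfies |C| ≤ 2·q^{(n−k)(k−δ+1)}. In other words, A_q(n,k,2δ) ≤ 2·q^{(n−k)(k−δ+1)} for δ > 1. -/
open Module

theorem pow_mul_sub_le_prod_sub_pow {q : ℝ} (hq : 2 ≤ q) {k t : ℕ} (htk : t ≤ k) :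
    q ^ (k * t) * (q ^ k - q ^ t) ≤ (∏ i : Fin t, (q ^ k - q ^ (i : ℕ))) * q ^ k := by
  induction t with
  | zero => simp
  | succ t ih =>
    have h := ih (by omega)
    have hle : q ^ t ≤ q ^ k := pow_le_pow_right₀ (by linarith) (by omega)
    have hkt : 0 ≤ q ^ (k * t) := by positivity
    have ht : 0 ≤ q ^ t := by positivity
    have hk : 0 ≤ q ^ k := by positivity
    rw [Fin.prod_univ_castSucc]
    simp only [Fin.val_castSucc, Fin.val_last]
    calc q ^ (k * (t + 1)) * (q ^ k - q ^ (t + 1))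
        = q ^ (k * t) * (q ^ k * (q ^ k - q ^ t * q)) := by ring
      _ ≤ q ^ (k * t) * ((q ^ k - q ^ t) * (q ^ k - q ^ t)) := by
          refine mul_le_mul_of_nonneg_left ?_ hkt
          nlinarith [mul_nonneg (mul_nonneg hk ht) (sub_nonneg.2 hq), mul_nonneg ht ht]
      _ = q ^ (k * t) * (q ^ k - q ^ t) * (q ^ k - q ^ t) := by ring
      _ ≤ (∏ i : Fin t, (q ^ k - q ^ (i : ℕ))) * q ^ k * (q ^ k - q ^ t) :=
          mul_le_mul_of_nonneg_right h (sub_nonneg.2 hle)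
      _ = _ := by ring

theorem pow_le_two_mul_prod_sub_pow {q k t : ℕ} (hq : 2 ≤ q) (htk : t < k) :
    q ^ (k * t) ≤ 2 * ∏ i : Fin t, (q ^ k - q ^ (i : ℕ)) := by
  have hq' : (2 : ℝ) ≤ q := by exact_mod_cast hq
  have h := pow_mul_sub_le_prod_sub_pow hq' htk.le
  have hcast : ((∏ i : Fin t, (q ^ k - q ^ (i : ℕ)) : ℕ) : ℝ)
      = ∏ i : Fin t, ((q : ℝ) ^ k - (q : ℝ) ^ (i : ℕ)) := by
    rw [Nat.cast_prod]
    refine Finset.prod_congr rfl fun i _ => ?_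
    rw [Nat.cast_sub (Nat.pow_le_pow_right (by omega) (by omega))]
    push_cast
    rfl
  have hhalf : 2 * (q : ℝ) ^ t ≤ (q : ℝ) ^ k := by
    calc 2 * (q : ℝ) ^ t ≤ q * (q : ℝ) ^ t := by gcongr
      _ = (q : ℝ) ^ (t + 1) := by ring
      _ ≤ (q : ℝ) ^ k := pow_le_pow_right₀ (by linarith) htk
  have hk : 0 < (q : ℝ) ^ k := by positivity
  have hkt : 0 ≤ (q : ℝ) ^ (k * t) := by positivity
  rw [← hcast] at h
  have hreal : (q : ℝ) ^ (k * t) ≤ 2 * ((∏ i : Fin t, (q ^ k - q ^ (i : ℕ)) : ℕ) : ℝ) := by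
    refine le_of_mul_le_mul_right ?_ hk
    nlinarith [mul_le_mul_of_nonneg_left hhalf hkt]
  exact_mod_cast hreal

/-- If any two distinct members of a family of `k`-dimensional subspaces meet in dimension less
than `t`, then a linearly independent `t`-tuple lies in at most one member of the family. -/
theorem card_mul_prod_le_of_finrank_inf_lt {F V : Type*} [Field F] [Fintype F] [AddCommGroup V]
    [Module F V] [Finite V] {k t : ℕ} (htk : t ≤ k) {C : Set (Submodule F V)}
    (hC : ∀ U ∈ C, finrank F U = k)
    (hinf : ∀ U ∈ C, ∀ W ∈ C, U ≠ W → finrank F ↥(U ⊓ W) < t) :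
    Nat.card C * ∏ i : Fin t, (Fintype.card F ^ k - Fintype.card F ^ (i : ℕ)) ≤
      ∏ i : Fin t, (Fintype.card F ^ finrank F V - Fintype.card F ^ (i : ℕ)) := by
  classical
  have := Fintype.ofFinite C
  have htV : C.Nonempty → t ≤ finrank F V := by
    rintro ⟨U, hU⟩
    exact htk.trans (hC U hU ▸ Submodule.finrank_le U)
  rcases C.eq_empty_or_nonempty with rfl | hne
  · simp
  let f : (Σ U : C, {s : Fin t → U.1 // LinearIndependent F s}) →
      {s : Fin t → V // LinearIndependent F s} :=
    fun x => ⟨fun i => x.2.1 i, x.2.2.map' x.1.1.subtype x.1.1.ker_subtype⟩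
  have hf : Function.Injective f := by
    rintro ⟨⟨U, hU⟩, s, hs⟩ ⟨⟨W, hW⟩, r, hr⟩ h
    have hsr : ∀ i, (s i : V) = r i := fun i => congrFun (congrArg Subtype.val h) i
    obtain rfl : U = W := by
      by_contra hUW
      let v : Fin t → ↥(U ⊓ W) := fun i => ⟨s i, (s i).2, hsr i ▸ (r i).2⟩
      have hv : LinearIndependent F v :=
        LinearIndependent.of_comp (U ⊓ W).subtype (hs.map' U.subtype U.ker_subtype)
      have := hv.fintype_card_le_finrank
      rw [Fintype.card_fin] at this
      exact absurd (hinf U hU W hW hUW) (not_lt.2 this)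
    obtain rfl : s = r := funext fun i => Subtype.ext (hsr i)
    rfl
  have hcard := Nat.card_le_card_of_injective f hf
  rw [Nat.card_sigma, card_linearIndependent (htV hne)] at hcard
  have hsum : ∀ U : C, Nat.card {s : Fin t → U.1 // LinearIndependent F s} =
      ∏ i : Fin t, (Fintype.card F ^ k - Fintype.card F ^ (i : ℕ)) := by
    intro U
    rw [card_linearIndependent (by rw [hC U U.2]; exact htk), hC U U.2]
  rw [Finset.sum_congr rfl fun U _ => hsum U] at hcard
  simpa [Nat.card_eq_fintype_card] using hcard

/-- Let `q` be a prime power (realized as the cardinality of a finite field `F`) and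
let `1 < δ ≤ k ≤ n - k`.  Then every set `C` of `k`-dimensional subspaces of `F_q^n`
in which any two distinct subspaces are at subspace distance
`d_S(U,V) = 2·dim(U+V) − dim U − dim V ≥ 2δ` satisfies
`|C| ≤ 2·q^{(n-k)(k-δ+1)}`.  In other words, `A_q(n,k,2δ) ≤ 2·q^{(n-k)(k-δ+1)}`. -/
theorem constant_dimension_code_upper_bound
    (F : Type*) [Field F] [Fintype F] (n k δ : ℕ)
    (hδ1 : 1 < δ) (hδk : δ ≤ k) (hkn : k ≤ n - k) :
    ∀ C : Set (Submodule F (Fin n → F)),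
      (∀ U ∈ C, Module.finrank F ↥U = k) →
      (∀ U ∈ C, ∀ V ∈ C, U ≠ V →
        2 * δ ≤ 2 * Module.finrank F ↥(U ⊔ V)
          - Module.finrank F ↥U - Module.finrank F ↥V) →
      Nat.card C ≤ 2 * Fintype.card F ^ ((n - k) * (k - δ + 1)) := by
  intro C hC hdist
  set q := Fintype.card F
  set t := k - δ + 1 with ht
  have hq : 2 ≤ q := Fintype.one_lt_card
  have hcount := card_mul_prod_le_of_finrank_inf_lt (t := t) (by omega) hC fun U hU W hW hUW => by
    have h := hdist U hU W hW hUW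
    have hadd := Submodule.finrank_sup_add_finrank_inf_eq U W
    rw [hC U hU, hC W hW] at h hadd
    omega
  rw [finrank_fin_fun] at hcount
  have hupper : ∏ i : Fin t, (q ^ n - q ^ (i : ℕ)) ≤ q ^ (n * t) := by
    calc ∏ i : Fin t, (q ^ n - q ^ (i : ℕ)) ≤ ∏ _i : Fin t, q ^ n :=
          Finset.prod_le_prod' fun i _ => Nat.sub_le _ _
      _ = q ^ (n * t) := by simp [pow_mul]
  refine Nat.le_of_mul_le_mul_right ?_ (show 0 < q ^ (k * t) by positivity)
  calc Nat.card C * q ^ (k * t)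
      ≤ Nat.card C * (2 * ∏ i : Fin t, (q ^ k - q ^ (i : ℕ))) :=
        Nat.mul_le_mul_left _ (pow_le_two_mul_prod_sub_pow hq (by omega))
    _ = 2 * (Nat.card C * ∏ i : Fin t, (q ^ k - q ^ (i : ℕ))) := by ring
    _ ≤ 2 * q ^ (n * t) := Nat.mul_le_mul_left _ (hcount.trans hupper)
    _ = 2 * q ^ ((n - k) * t) * q ^ (k * t) := by
        rw [mul_assoc, ← pow_add, ← add_mul, Nat.sub_add_cancel (by omega)]
end

section
/- Let q be a prime power and let δ, k, n be integers with 1 ≤ δ ≤ k ≤ n − k. Then every set C of k-dimensional subspaces of F_q^n with minimum subspace distance at least 2δ satisfies |C| ≤ 4·q^{(n−k)(k−δ+1)}; in particular A_q(n,k,2) ≤ 4·q^{(n−k)k} and q^{(n−k)k} ≤ A_q(n,k,2). -/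
open Module

/-- `maxCodeCard F n k d` is `A_q(n,k,d)`: the maximum cardinality of a set of
`k`-dimensional subspaces of `F_q^n` in which any two distinct elements are at
subspace distance `d_S(U,V) = 2·dim(U+V) − dim U − dim V` at least `d`. -/
noncomputable def maxCodeCard (F : Type*) [Field F] [Fintype F] (n k d : ℕ) : ℕ :=
  sSup {m : ℕ | ∃ C : Set (Submodule F (Fin n → F)),
    (∀ U ∈ C, Module.finrank F ↥U = k) ∧
    (∀ U ∈ C, ∀ V ∈ C, U ≠ V →
      d ≤ 2 * Module.finrank F ↥(U ⊔ V)
        - Module.finrank F ↥U - Module.finrank F ↥V) ∧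
    Nat.card C = m}

theorem one_quarter_add_half_pow_le_prod_one_sub_pow {x : ℝ} (hx0 : 0 ≤ x) (hx : x ≤ 1 / 2)
    (m : ℕ) : 1 / 4 + x ^ (m + 1) / 2 ≤ ∏ j ∈ Finset.range (m + 1), (1 - x ^ (j + 1)) := by
  induction m with
  | zero => simp; linarith
  | succ m ih =>
    rw [Finset.prod_range_succ]
    have hy0 : 0 ≤ x ^ (m + 1) := by positivity
    have hy : x ^ (m + 1) ≤ 1 / 2 :=
      (pow_le_of_le_one hx0 (by linarith) m.succ_ne_zero).trans hx
    have hxy : x * x ^ (m + 1) ≤ 1 / 4 := by nlinarith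
    have key : 1 / 4 + x ^ (m + 1 + 1) / 2 ≤
        (1 / 4 + x ^ (m + 1) / 2) * (1 - x ^ (m + 1 + 1)) := by
      rw [pow_succ' x (m + 1)]
      nlinarith [mul_nonneg hy0 (by linarith : 0 ≤ 1 / 2 - 3 * x / 4 - x * x ^ (m + 1) / 2)]
    refine key.trans (mul_le_mul_of_nonneg_right ih ?_)
    rw [pow_succ' x (m + 1)]
    linarith

theorem one_quarter_le_prod_one_sub_pow {x : ℝ} (hx0 : 0 ≤ x) (hx : x ≤ 1 / 2) (m : ℕ) :
    1 / 4 ≤ ∏ j ∈ Finset.range m, (1 - x ^ (j + 1)) := by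
  cases m with
  | zero => norm_num
  | succ m =>
    have := one_quarter_add_half_pow_le_prod_one_sub_pow hx0 hx m
    have : 0 ≤ x ^ (m + 1) := by positivity
    linarith

theorem pow_mul_le_four_mul_prod_pow_sub_pow {q k t : ℕ} (hq : 2 ≤ q) (htk : t ≤ k) :
    q ^ (k * t) ≤ 4 * ∏ i : Fin t, (q ^ k - q ^ (i : ℕ)) := by
  have hq0 : (0 : ℝ) < q := by exact_mod_cast (by omega : 0 < q)
  have hx0 : (0 : ℝ) ≤ (q : ℝ)⁻¹ := by positivity
  have hx : (q : ℝ)⁻¹ ≤ 1 / 2 := by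
    rw [one_div]
    exact inv_anti₀ (by norm_num) (by exact_mod_cast hq)
  have hfac : ∀ i < k, ((q ^ k - q ^ i : ℕ) : ℝ) = (q : ℝ) ^ k * (1 - (q : ℝ)⁻¹ ^ (k - i)) := by
    intro i hi
    rw [Nat.cast_sub (Nat.pow_le_pow_right (by omega) hi.le)]
    obtain ⟨c, rfl⟩ := Nat.exists_eq_add_of_le hi.le
    rw [Nat.add_sub_cancel_left, inv_pow, pow_add]
    push_cast
    field_simp
    ring
  have hprod : (1 : ℝ) / 4 ≤ ∏ i ∈ Finset.range t, (1 - (q : ℝ)⁻¹ ^ (k - i)) := by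
    refine (one_quarter_le_prod_one_sub_pow hx0 hx k).trans ?_
    rw [← Finset.prod_range_reflect]
    have hreflect : ∏ j ∈ Finset.range k, (1 - (q : ℝ)⁻¹ ^ (k - 1 - j + 1)) =
        ∏ i ∈ Finset.range k, (1 - (q : ℝ)⁻¹ ^ (k - i)) := by
      refine Finset.prod_congr rfl fun i hi => ?_
      rw [Finset.mem_range] at hi
      congr 2
      omega
    rw [hreflect]
    refine Finset.prod_le_prod_of_subset_of_le_one
      (Finset.range_subset_range.2 htk) (fun i _ => sub_nonneg.2 ?_) fun i _ _ => ?_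
    · exact pow_le_one₀ hx0 (by linarith)
    · exact sub_le_self _ (by positivity)
  rw [Fin.prod_univ_eq_prod_range (fun i => q ^ k - q ^ i) t]
  have : ((q ^ (k * t) : ℕ) : ℝ) ≤ ((4 * ∏ i ∈ Finset.range t, (q ^ k - q ^ i) : ℕ) : ℝ) := by
    rw [Nat.cast_mul, Nat.cast_prod, Finset.prod_congr rfl fun i hi =>
      hfac i ((Finset.mem_range.1 hi).trans_le htk), Finset.prod_mul_distrib, Finset.prod_const,
      Finset.card_range, ← pow_mul]
    push_cast
    nlinarith [pow_pos hq0 (k * t)]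
  exact_mod_cast this

/-- Two members of a family of subspaces with pairwise small intersections share no linearly
independent `t`-tuple, so the tuples contained in the members can be counted in the ambient space. -/
theorem card_mul_prod_le_pow_of_finrank_inf_lt {F V : Type*} [Field F] [Fintype F]
    [AddCommGroup V] [Module F V] [Finite V] {k t : ℕ} (htk : t ≤ k)
    (C : Set (Submodule F V)) (hC : ∀ U ∈ C, finrank F U = k)
    (hinf : ∀ U ∈ C, ∀ W ∈ C, U ≠ W → finrank F ↥(U ⊓ W) < t) :
    Nat.card C * ∏ i : Fin t, (Fintype.card F ^ k - Fintype.card F ^ (i : ℕ)) ≤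
      Fintype.card F ^ (finrank F V * t) := by
  have : Fintype V := Fintype.ofFinite V
  have hcard (U : C) : Nat.card {s : Fin t → U.1 // LinearIndependent F s} =
      ∏ i : Fin t, (Fintype.card F ^ k - Fintype.card F ^ (i : ℕ)) := by
    have := Fintype.ofFinite U.1
    rw [card_linearIndependent (by rw [hC U.1 U.2]; exact htk), hC U.1 U.2]
  have hsigma : Nat.card ((U : C) × {s : Fin t → U.1 // LinearIndependent F s}) =
      Nat.card C * ∏ i : Fin t, (Fintype.card F ^ k - Fintype.card F ^ (i : ℕ)) := by
    have := Fintype.ofFinite C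
    rw [Nat.card_sigma, Finset.sum_congr rfl fun U _ => hcard U]
    simp
  have htuple : Nat.card (Fin t → V) = Fintype.card F ^ (finrank F V * t) := by
    rw [Nat.card_fun, Nat.card_eq_fintype_card (α := V), Module.card_eq_pow_finrank (K := F),
      Nat.card_eq_fintype_card, Fintype.card_fin, pow_mul]
  rw [← hsigma, ← htuple]
  refine Nat.card_le_card_of_injective (fun p i => (p.2.1 i : V)) ?_
  rintro ⟨U, s, hs⟩ ⟨W, s', hs'⟩ h
  have hval (i : Fin t) : (s i : V) = s' i := congrFun h i
  obtain rfl : U = W := by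
    by_contra hUW
    refine absurd (hinf U U.2 W W.2 fun h => hUW (Subtype.ext h)) (not_lt.2 ?_)
    let r : Fin t → ↥(U.1 ⊓ W.1) := fun i => ⟨s i, (s i).2, hval i ▸ (s' i).2⟩
    have hr : LinearIndependent F r :=
      LinearIndependent.of_comp (U.1 ⊓ W.1).subtype (hs.map' U.1.subtype U.1.ker_subtype)
    simpa using hr.fintype_card_le_finrank
  congr
  exact funext fun i => Subtype.ext (hval i)

theorem card_le_four_mul_pow_of_subspace_distance {F : Type*} [Field F] [Fintype F] {n k δ : ℕ}
    (hδ1 : 1 ≤ δ) (hδk : δ ≤ k) (hkn : k ≤ n) (C : Set (Submodule F (Fin n → F)))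
    (hC : ∀ U ∈ C, finrank F U = k)
    (hdist : ∀ U ∈ C, ∀ V ∈ C, U ≠ V →
      2 * δ ≤ 2 * finrank F ↥(U ⊔ V) - finrank F U - finrank F V) :
    Nat.card C ≤ 4 * Fintype.card F ^ ((n - k) * (k - δ + 1)) := by
  have hq : 2 ≤ Fintype.card F := Fintype.one_lt_card
  set q := Fintype.card F
  set t := k - δ + 1
  have htk : t ≤ k := by omega
  have hcount := card_mul_prod_le_pow_of_finrank_inf_lt htk C hC fun U hU W hW hUW => by
    have h := hdist U hU W hW hUW
    have hsum := Submodule.finrank_sup_add_finrank_inf_eq U W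
    rw [hC U hU, hC W hW] at h hsum
    omega
  rw [finrank_fin_fun] at hcount
  have hprod := pow_mul_le_four_mul_prod_pow_sub_pow hq htk
  refine Nat.le_of_mul_le_mul_right ?_ (pow_pos (by omega : 0 < q) (k * t))
  calc Nat.card C * q ^ (k * t)
      ≤ Nat.card C * (4 * ∏ i : Fin t, (q ^ k - q ^ (i : ℕ))) := Nat.mul_le_mul_left _ hprod
    _ = 4 * (Nat.card C * ∏ i : Fin t, (q ^ k - q ^ (i : ℕ))) := by ring
    _ ≤ 4 * q ^ (n * t) := Nat.mul_le_mul_left _ hcount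
    _ = 4 * q ^ ((n - k) * t) * q ^ (k * t) := by
      rw [mul_assoc, ← pow_add, ← add_mul, Nat.sub_add_cancel hkn]

/-- Graphs of linear maps from a `k`-dimensional to an `(n - k)`-dimensional space provide this
many `k`-dimensional subspaces. -/
theorem pow_le_card_submodule_finrank_eq (F : Type*) [Field F] [Fintype F] {n k : ℕ}
    (hkn : k ≤ n) :
    Fintype.card F ^ ((n - k) * k) ≤
      Nat.card {U : Submodule F (Fin n → F) | finrank F U = k} := by
  let e : ((Fin k → F) × (Fin (n - k) → F)) ≃ₗ[F] (Fin n → F) :=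
    LinearEquiv.ofFinrankEq _ _ (by simp; omega)
  have hcard : Nat.card ((Fin k → F) →ₗ[F] (Fin (n - k) → F)) =
      Fintype.card F ^ ((n - k) * k) := by
    rw [Module.natCard_eq_pow_finrank (K := F), Module.finrank_linearMap, finrank_fin_fun,
      finrank_fin_fun, Nat.card_eq_fintype_card, mul_comm]
  rw [← hcard]
  refine Nat.card_le_card_of_injective (fun f => ⟨f.graph.map e.toLinearMap, ?_⟩) ?_
  · rw [Set.mem_ofPred_eq, LinearEquiv.finrank_map_eq, LinearMap.graph_eq_range_prod,
      LinearMap.finrank_range_of_inj, finrank_fin_fun]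
    exact fun x y h => (Prod.ext_iff.1 h).1
  · intro f g h
    have hgraph : f.graph = g.graph :=
      Submodule.map_injective_of_injective e.injective (congrArg Subtype.val h)
    refine LinearMap.ext fun x => ?_
    have hmem : (x, f x) ∈ g.graph := hgraph ▸ (f.mem_graph_iff (x, f x)).2 rfl
    exact (g.mem_graph_iff (x, f x)).1 hmem

theorem two_le_subspace_distance {F V : Type*} [Field F] [AddCommGroup V] [Module F V]
    [FiniteDimensional F V] {U W : Submodule F V} (hUW : U ≠ W)
    (h : finrank F U = finrank F W) :
    2 ≤ 2 * finrank F ↥(U ⊔ W) - finrank F U - finrank F W := by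
  have hlt : finrank F U < finrank F ↥(U ⊔ W) := by
    refine Submodule.finrank_lt_finrank_of_lt (lt_of_le_of_ne le_sup_left fun heq => hUW ?_)
    exact (Submodule.eq_of_le_of_finrank_eq (le_sup_right.trans heq.ge) h.symm).symm
  omega

/-- Let `q` be a prime power (realized as the cardinality of a finite field `F`) and
let `1 ≤ δ ≤ k ≤ n - k`.  Then every set `C` of `k`-dimensional subspaces of `F_q^n`
with minimum subspace distance at least `2δ` satisfies `|C| ≤ 4·q^{(n-k)(k-δ+1)}`;
in particular `A_q(n,k,2) ≤ 4·q^{(n-k)k}` and `q^{(n-k)k} ≤ A_q(n,k,2)`. -/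
theorem constant_dimension_code_bounds_distance_two
    (F : Type*) [Field F] [Fintype F] (n k δ : ℕ)
    (hδ1 : 1 ≤ δ) (hδk : δ ≤ k) (hkn : k ≤ n - k) :
    (∀ C : Set (Submodule F (Fin n → F)),
      (∀ U ∈ C, Module.finrank F ↥U = k) →
      (∀ U ∈ C, ∀ V ∈ C, U ≠ V →
        2 * δ ≤ 2 * Module.finrank F ↥(U ⊔ V)
          - Module.finrank F ↥U - Module.finrank F ↥V) →
      Nat.card C ≤ 4 * Fintype.card F ^ ((n - k) * (k - δ + 1))) ∧
    Fintype.card F ^ ((n - k) * k) ≤ maxCodeCard F n k 2 ∧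
    maxCodeCard F n k 2 ≤ 4 * Fintype.card F ^ ((n - k) * k) := by
  have hkn' : k ≤ n := by omega
  have hmax : ∀ m ∈ {m : ℕ | ∃ C : Set (Submodule F (Fin n → F)),
      (∀ U ∈ C, Module.finrank F ↥U = k) ∧
      (∀ U ∈ C, ∀ V ∈ C, U ≠ V →
        2 ≤ 2 * Module.finrank F ↥(U ⊔ V)
          - Module.finrank F ↥U - Module.finrank F ↥V) ∧
      Nat.card C = m}, m ≤ 4 * Fintype.card F ^ ((n - k) * k) := by
    rintro m ⟨C, hC, hdist, rfl⟩
    have h := card_le_four_mul_pow_of_subspace_distance le_rfl (hδ1.trans hδk) hkn' C hC hdist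
    rwa [Nat.sub_add_cancel (hδ1.trans hδk)] at h
  refine ⟨card_le_four_mul_pow_of_subspace_distance hδ1 hδk hkn', ?_, ?_⟩
  · refine (pow_le_card_submodule_finrank_eq F hkn').trans (le_csSup ⟨_, hmax⟩ ?_)
    exact ⟨_, fun U hU => hU,
      fun U hU V hV hUV => two_le_subspace_distance hUV (hU.trans hV.symm), rfl⟩
  · exact csSup_le ⟨0, ∅, by simp⟩ hmax
end

section
/- (Singleton-like bound for rank-metric codes.) Let q be a prime power, m, n ≥ 1, and 1 ≤ δ ≤ min{m,n}. If V is an F_q-linear subspace of the space of m×n matrices over F_q such that every nonzero element of V has rank at least δ, then dim_{F_q}(V) ≤ max{m,n}·(min{m,n} − δ + 1). -/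
open Module Matrix

/-- Deleting `δ - 1` columns is injective on a code of minimum rank at least `δ`. -/
theorem finrank_le_mul_of_forall_le_rank {F : Type*} [Field F] {m n δ : ℕ}
    (hδ1 : 1 ≤ δ) (hδ : δ ≤ n) (V : Submodule F (Matrix (Fin m) (Fin n) F))
    (hV : ∀ A ∈ V, A ≠ 0 → δ ≤ A.rank) :
    Module.finrank F ↥V ≤ m * (n - δ + 1) := by
  let f : Fin (n - δ + 1) → Fin n := Fin.castLE (by omega)
  let L : Matrix (Fin m) (Fin n) F →ₗ[F] Matrix (Fin m) (Fin (n - δ + 1)) F :=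
    { toFun := fun A => A.submatrix id f
      map_add' := fun _ _ => rfl
      map_smul' := fun _ _ => rfl }
  have hL : Function.Injective (L.domRestrict V) := by
    rw [← LinearMap.ker_eq_bot, LinearMap.ker_eq_bot']
    rintro ⟨A, hA⟩ h0
    by_contra hne
    have hrank := hV A hA fun h => hne (Subtype.ext h)
    have hzero (i : Fin m) (j : Fin (n - δ + 1)) : A i (f j) = 0 :=
      congrFun (congrFun h0 i) j
    have hfinj : Function.Injective f := Fin.castLE_injective _
    have hle : Aᵀ.rank ≤ ((Finset.univ.image f)ᶜ).card := by
      refine rank_le_card_of_support_subset _ _ fun j hj => ?_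
      simp only [Finset.coe_compl, Finset.coe_image, Finset.coe_univ, Set.image_univ,
        Set.mem_compl_iff]
      rintro ⟨k, rfl⟩
      exact hj (funext fun i => hzero i k)
    rw [rank_transpose, Finset.card_compl, Finset.card_image_of_injective _ hfinj,
      Finset.card_univ, Fintype.card_fin, Fintype.card_fin] at hle
    omega
  simpa [Module.finrank_matrix] using LinearMap.finrank_le_finrank_of_injective hL

/-- Singleton-like bound for rank-metric codes.  Let `q` be a prime power (realized as
the cardinality of a finite field `F`), `m, n ≥ 1`, and `1 ≤ δ ≤ min{m,n}`.  If `V` is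
an `F_q`-linear subspace of the `m×n` matrices over `F_q` such that every nonzero
element of `V` has rank at least `δ`, then
`dim_{F_q}(V) ≤ max{m,n}·(min{m,n} − δ + 1)`. -/
theorem rank_metric_singleton_bound
    (F : Type*) [Field F] [Fintype F] (m n δ : ℕ)
    (hm : 1 ≤ m) (hn : 1 ≤ n) (hδ1 : 1 ≤ δ) (hδ : δ ≤ min m n)
    (V : Submodule F (Matrix (Fin m) (Fin n) F))
    (hV : ∀ A ∈ V, A ≠ 0 → δ ≤ A.rank) :
    Module.finrank F ↥V ≤ max m n * (min m n - δ + 1) := by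
  rcases le_total n m with h | h
  · rw [max_eq_left h, min_eq_right h] at *
    exact finrank_le_mul_of_forall_le_rank hδ1 hδ V hV
  · rw [max_eq_right h, min_eq_left h] at *
    let e := Matrix.transposeLinearEquiv (Fin m) (Fin n) F F
    rw [← LinearEquiv.finrank_map_eq e V]
    refine finrank_le_mul_of_forall_le_rank hδ1 hδ _ ?_
    rintro _ ⟨A, hA, rfl⟩ hne
    change δ ≤ Aᵀ.rank
    rw [rank_transpose]
    exact hV A hA fun h0 => hne (by simp [h0])
end

section
/- There exists a set of 51 two-dimensional subspaces of F_2^6 such that any three distinct subspaces from the set together span a subspace of F_2^6 of dimension at least 4. -/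
open Module

namespace LiftedPlane

/-- The first generator of the plane attached to `m`. -/
def fstRow (m : Fin 6 → ZMod 2) : Fin 6 → ZMod 2 := ![1, 0, m 0, m 1, m 2, m 3]

/-- The second generator of the plane attached to `m`. -/
def sndRow (m : Fin 6 → ZMod 2) : Fin 6 → ZMod 2 := ![0, 1, m 4, m 5, m 0, m 1]

/-- The row space of the matrix `(I | M)`, where the `2 × 4` matrix `M` runs through a
six-dimensional linear code as `m` varies. For no nonzero `v` does this code contain all
matrices whose rows are multiples of `v`. -/
def plane (m : Fin 6 → ZMod 2) : Submodule (ZMod 2) (Fin 6 → ZMod 2) :=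
  Submodule.span (ZMod 2) {fstRow m, sndRow m}

lemma fstRow_mem (m : Fin 6 → ZMod 2) : fstRow m ∈ plane m :=
  Submodule.subset_span (by simp)

lemma sndRow_mem (m : Fin 6 → ZMod 2) : sndRow m ∈ plane m :=
  Submodule.subset_span (by simp)

lemma eq_zero_of_mem_plane {m x : Fin 6 → ZMod 2} (hx : x ∈ plane m) (h0 : x 0 = 0)
    (h1 : x 1 = 0) : x = 0 := by
  obtain ⟨a, b, rfl⟩ := Submodule.mem_span_pair.1 hx
  have ha : a = 0 := by simpa [fstRow, sndRow] using h0
  have hb : b = 0 := by simpa [fstRow, sndRow] using h1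
  simp [ha, hb]

lemma finrank_plane (m : Fin 6 → ZMod 2) : finrank (ZMod 2) (plane m) = 2 := by
  have h : LinearIndependent (ZMod 2) ![fstRow m, sndRow m] := by
    refine LinearIndependent.pair_iff.2 fun a b hab => ⟨?_, ?_⟩
    · simpa [fstRow, sndRow] using congrFun hab 0
    · simpa [fstRow, sndRow] using congrFun hab 1
  rw [plane, ← Matrix.range_cons_cons_empty (fstRow m) (sndRow m) ![], finrank_span_eq_card h,
    Fintype.card_fin]

lemma plane_injective : Function.Injective plane := by
  intro m n h
  have hf : fstRow m - fstRow n = 0 := eq_zero_of_mem_plane (m := n)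
    (sub_mem (h ▸ fstRow_mem m) (fstRow_mem n)) (by simp [fstRow]) (by simp [fstRow])
  have hs : sndRow m - sndRow n = 0 := eq_zero_of_mem_plane (m := n)
    (sub_mem (h ▸ sndRow_mem m) (sndRow_mem n)) (by simp [sndRow]) (by simp [sndRow])
  simp [fstRow, sndRow, sub_eq_zero] at hf hs
  ext i
  fin_cases i <;> simp [hf, hs]

lemma four_le_finrank {T : Submodule (ZMod 2) (Fin 6 → ZMod 2)} {m x y : Fin 6 → ZMod 2}
    (hm : plane m ≤ T) (hx : x ∈ T) (hy : y ∈ T) (hx0 : x 0 = 0) (hx1 : x 1 = 0)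
    (hy0 : y 0 = 0) (hy1 : y 1 = 0) (hxne : x ≠ 0) (hyne : y ≠ 0) (hxy : x ≠ y) :
    4 ≤ finrank (ZMod 2) T := by
  have h : LinearIndependent (ZMod 2) ![fstRow m, sndRow m, x, y] := by
    refine Fintype.linearIndependent_iff.2 fun g hg => ?_
    simp only [Fin.sum_univ_four, Matrix.cons_val] at hg
    have h0 : g 0 = 0 := by
      simpa only [fstRow, sndRow, Pi.add_apply, Pi.smul_apply, Pi.zero_apply, Matrix.cons_val,
        hx0, hy0, mul_zero, add_zero, smul_eq_mul, mul_one] using congrFun hg 0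
    have h1 : g 1 = 0 := by
      simpa only [fstRow, sndRow, Pi.add_apply, Pi.smul_apply, Pi.zero_apply, Matrix.cons_val,
        hx1, hy1, mul_zero, add_zero, zero_add, smul_eq_mul, mul_one] using congrFun hg 1
    have hpair : LinearIndependent (ZMod 2) ![x, y] := by
      refine (LinearIndependent.pair_iff' hxne).2 fun a ha => ?_
      obtain rfl | rfl : a = 0 ∨ a = 1 := (by decide : ∀ a : ZMod 2, a = 0 ∨ a = 1) a
      · exact hyne (by simpa using ha.symm)
      · exact hxy (by simpa using ha)
    have h23 := LinearIndependent.pair_iff.1 hpair (g 2) (g 3) (by simpa [h0, h1] using hg)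
    intro i
    fin_cases i
    exacts [h0, h1, h23.1, h23.2]
  have hle : Submodule.span (ZMod 2) (Set.range ![fstRow m, sndRow m, x, y]) ≤ T := by
    refine Submodule.span_le.2 (Set.range_subset_iff.2 fun i => ?_)
    fin_cases i
    exacts [hm (fstRow_mem m), hm (sndRow_mem m), hx, hy]
  simpa [finrank_span_eq_card h] using Submodule.finrank_mono hle

lemma four_le_finrank_sup {m n p : Fin 6 → ZMod 2} (hmn : m ≠ n) (hmp : m ≠ p) (hnp : n ≠ p) :
    4 ≤ finrank (ZMod 2) ↥(plane m ⊔ plane n ⊔ plane p) := by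
  set T := plane m ⊔ plane n ⊔ plane p
  have hm : plane m ≤ T := le_sup_left.trans le_sup_left
  have hn : plane n ≤ T := le_sup_right.trans le_sup_left
  have hp : plane p ≤ T := le_sup_right
  by_contra hT
  have key {x y : Fin 6 → ZMod 2} (hx : x ∈ T) (hy : y ∈ T) (hx0 : x 0 = 0) (hx1 : x 1 = 0)
      (hy0 : y 0 = 0) (hy1 : y 1 = 0) : x = 0 ∨ y = 0 ∨ x = y := by
    by_contra! h
    exact hT (four_le_finrank hm hx hy hx0 hx1 hy0 hy1 h.1 h.2.1 h.2.2)
  have hfn := sub_mem (hm (fstRow_mem m)) (hn (fstRow_mem n))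
  have hsn := sub_mem (hm (sndRow_mem m)) (hn (sndRow_mem n))
  have hfp := sub_mem (hm (fstRow_mem m)) (hp (fstRow_mem p))
  have hsp := sub_mem (hm (sndRow_mem m)) (hp (sndRow_mem p))
  have h1 := key hfn hsn
  have h2 := key hfn hfp
  have h3 := key hfn hsp
  have h4 := key hsn hfp
  have h5 := key hsn hsp
  have h6 := key hfp hsp
  simp [fstRow, sndRow] at h1 h2 h3 h4 h5 h6
  simp only [ne_eq, funext_iff, Fin.forall_fin_succ] at hmn hmp hnp
  simp at hmn hmp hnp
  grind

end LiftedPlane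

open LiftedPlane in
/-- There exists a set of 51 two-dimensional subspaces of `F_2^6` such that any three
distinct subspaces from the set together span a subspace of `F_2^6` of dimension at
least `4`. -/
theorem exists_51_planes_in_F2_6 :
    ∃ S : Finset (Submodule (ZMod 2) (Fin 6 → ZMod 2)),
      S.card = 51 ∧
      (∀ U ∈ S, Module.finrank (ZMod 2) ↥U = 2) ∧
      (∀ U ∈ S, ∀ V ∈ S, ∀ W ∈ S, U ≠ V → U ≠ W → V ≠ W →
        4 ≤ Module.finrank (ZMod 2) ↥(U ⊔ V ⊔ W)) := by
  obtain ⟨P, -, hP⟩ := Finset.exists_subset_card_eq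
    (s := (Finset.univ : Finset (Fin 6 → ZMod 2))) (n := 51) (by simp [ZMod.card])
  refine ⟨P.map ⟨plane, plane_injective⟩, by simpa using hP, ?_, ?_⟩
  · simp [finrank_plane]
  · simp only [Finset.mem_map, Function.Embedding.coeFn_mk]
    rintro _ ⟨m, -, rfl⟩ _ ⟨n, -, rfl⟩ _ ⟨p, -, rfl⟩ hmn hmp hnp
    exact four_le_finrank_sup (ne_of_apply_ne plane hmn) (ne_of_apply_ne plane hmp)
      (ne_of_apply_ne plane hnp)
end
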